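/- Let Ψ : (0,1] → (0,∞) be decreasing and differentiable such that s ↦ sΨ(s) is increasing on (0,1], with the normalization ∫₀¹ ds/(sΨ(s)) = 1. Let n ≥ 1, let α₁,…,αₙ ≥ 0 with Σ_{k=1}^n α_k = 1, let f₁,…,fₙ ∈ ℝ, let N₁,…,Nₙ be distribution functions with ∫₀^∞ N_k(t) dt > 0 for each k, let M₁,…,Mₙ ∈ [0,1], let a ≥ 0, and suppose f = Σ_{k=1}^n α_k f_k, N = Σ_{k=1}^n α_k N_k, and M = a + Σ_{k=1}^n α_k M_k with M ∈ [0,1]. Then −B̃(f, N, M) + Σ_{k=1}^n α_k B̃(f_k, N_k, M_k) ≥ (1/16)·a·f²/n_Ψ(N), where if n_Ψ(N) = ∞ the right-hand side is interpreted as 0. -/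

import Mathlib

open MeasureTheory

/-- `n_Ψ(N) = ∫₀^∞ N(t)Ψ(N(t)) dt`, integrand taken to be `0` where `N(t) = 0`.
(The Bochner integral is `0` when the integrand is not integrable, which implements the
convention that the right-hand side below is `0` when `n_Ψ(N) = ∞`.) -/
noncomputable def nPsi (Ψ N : ℝ → ℝ) : ℝ :=
  ∫ t in Set.Ioi (0:ℝ), (if N t = 0 then 0 else N t * Ψ (N t))

/-- The auxiliary function `T(A, N) = N·∫₀^{N/A} ds/φ(s)` with `φ(s) = sΨ(s)`. -/
noncomputable def TT (Ψ : ℝ → ℝ) (A N : ℝ) : ℝ :=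
  N * ∫ s in Set.Ioo (0:ℝ) (N / A), (s * Ψ s)⁻¹

/-- `𝐓(A, N) = ∫₀^∞ T(A, N(t)) dt` for a distribution function `N`. -/
noncomputable def bigT (Ψ : ℝ → ℝ) (A : ℝ) (N : ℝ → ℝ) : ℝ :=
  ∫ t in Set.Ioi (0:ℝ), TT Ψ A (N t)

/-- `u(M, N) = 2∫₀^∞ N(t) dt − 𝐓(M+1, N)`. -/
noncomputable def uMN (Ψ : ℝ → ℝ) (M : ℝ) (N : ℝ → ℝ) : ℝ :=
  2 * (∫ t in Set.Ioi (0:ℝ), N t) - bigT Ψ (M + 1) N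

/-- The Bellman function `B̃(f, N, M) = f²/u(M, N)`. -/
noncomputable def B3 (Ψ : ℝ → ℝ) (f : ℝ) (N : ℝ → ℝ) (M : ℝ) : ℝ :=
  f ^ 2 / uMN Ψ M N

/-- A distribution function: decreasing `N : [0,∞) → [0,1]` with `∫₀^∞ N < ∞`. -/
def IsDistFun (N : ℝ → ℝ) : Prop :=
  AntitoneOn N (Set.Ici 0) ∧ (∀ t, 0 ≤ t → N t ∈ Set.Icc (0:ℝ) 1) ∧
    MeasureTheory.IntegrableOn N (Set.Ioi 0)

/-- The primitive `∫₀ˣ ds/φ(s)`, where `φ(s) = sΨ(s)`. -/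
noncomputable def primInv (Ψ : ℝ → ℝ) (x : ℝ) : ℝ :=
  ∫ s in Set.Ioo (0:ℝ) x, (s * Ψ s)⁻¹

lemma primInv_zero (Ψ : ℝ → ℝ) : primInv Ψ 0 = 0 := by simp [primInv]

lemma primInv_sub {Ψ : ℝ → ℝ}
    (hint : IntegrableOn (fun s => (s * Ψ s)⁻¹) (Set.Ioo (0:ℝ) 1))
    {x y : ℝ} (hx : 0 ≤ x) (hxy : x ≤ y) (hy : y ≤ 1) :
    primInv Ψ y - primInv Ψ x = ∫ s in x..y, (s * Ψ s)⁻¹ := by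
  have h01 : IntervalIntegrable (fun s => (s * Ψ s)⁻¹) volume 0 1 := by
    rw [intervalIntegrable_iff_integrableOn_Ioo_of_le zero_le_one]
    exact hint
  have hsub : ∀ z, 0 ≤ z → z ≤ 1 →
      IntervalIntegrable (fun s => (s * Ψ s)⁻¹) volume 0 z := fun z h0 h1 =>
    h01.mono_set (by
      rw [Set.uIcc_of_le h0, Set.uIcc_of_le zero_le_one]
      exact Set.Icc_subset_Icc le_rfl h1)
  have hg : ∀ z, 0 ≤ z → primInv Ψ z = ∫ s in (0:ℝ)..z, (s * Ψ s)⁻¹ := fun z h0 => by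
    rw [intervalIntegral.integral_of_le h0, integral_Ioc_eq_integral_Ioo, primInv]
  rw [hg y (hx.trans hxy), hg x hx]
  exact intervalIntegral.integral_interval_sub_left (hsub y (hx.trans hxy) hy)
    (hsub x hx (hxy.trans hy))

lemma primInv_sub_bounds {Ψ : ℝ → ℝ} (hΨpos : ∀ s ∈ Set.Ioc (0:ℝ) 1, 0 < Ψ s)
    (hφinc : MonotoneOn (fun s => s * Ψ s) (Set.Ioc (0:ℝ) 1))
    (hint : IntegrableOn (fun s => (s * Ψ s)⁻¹) (Set.Ioo (0:ℝ) 1))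
    {x y : ℝ} (hx : 0 < x) (hxy : x ≤ y) (hy : y ≤ 1) :
    (y - x) * (y * Ψ y)⁻¹ ≤ primInv Ψ y - primInv Ψ x ∧
      primInv Ψ y - primInv Ψ x ≤ (y - x) * (x * Ψ x)⁻¹ := by
  have hii : IntervalIntegrable (fun s => (s * Ψ s)⁻¹) volume x y := by
    rw [intervalIntegrable_iff_integrableOn_Ioo_of_le hxy]
    exact hint.mono_set (Set.Ioo_subset_Ioo hx.le hy)
  have hpos : ∀ s, 0 < s → s ≤ 1 → 0 < s * Ψ s := fun s h0 h1 => mul_pos h0 (hΨpos s ⟨h0, h1⟩)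
  rw [primInv_sub hint hx.le hxy hy, ← smul_eq_mul, ← smul_eq_mul (y - x) (x * Ψ x)⁻¹,
    ← intervalIntegral.integral_const, ← intervalIntegral.integral_const]
  exact ⟨intervalIntegral.integral_mono_on hxy intervalIntegrable_const hii fun s hs =>
      inv_anti₀ (hpos s (hx.trans_le hs.1) (hs.2.trans hy))
        (hφinc ⟨hx.trans_le hs.1, hs.2.trans hy⟩ ⟨hx.trans_le hxy, hy⟩ hs.2),
    intervalIntegral.integral_mono_on hxy hii intervalIntegrable_const fun s hs =>
      inv_anti₀ (hpos x hx (hxy.trans hy))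
        (hφinc ⟨hx, hxy.trans hy⟩ ⟨hx.trans_le hs.1, hs.2.trans hy⟩ hs.1)⟩

lemma primInv_mono {Ψ : ℝ → ℝ} (hΨpos : ∀ s ∈ Set.Ioc (0:ℝ) 1, 0 < Ψ s)
    (hint : IntegrableOn (fun s => (s * Ψ s)⁻¹) (Set.Ioo (0:ℝ) 1))
    {x y : ℝ} (hx : 0 ≤ x) (hxy : x ≤ y) (hy : y ≤ 1) : primInv Ψ x ≤ primInv Ψ y := by
  rw [← sub_nonneg, primInv_sub hint hx hxy hy, intervalIntegral.integral_of_le hxy]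
  refine setIntegral_nonneg measurableSet_Ioc fun s hs => ?_
  have hs0 : 0 < s := hx.trans_lt hs.1
  exact (inv_pos.2 (mul_pos hs0 (hΨpos s ⟨hs0, hs.2.trans hy⟩))).le

lemma primInv_nonneg {Ψ : ℝ → ℝ} (hΨpos : ∀ s ∈ Set.Ioc (0:ℝ) 1, 0 < Ψ s)
    (hint : IntegrableOn (fun s => (s * Ψ s)⁻¹) (Set.Ioo (0:ℝ) 1))
    {x : ℝ} (hx : x ∈ Set.Icc (0:ℝ) 1) : 0 ≤ primInv Ψ x := by
  simpa [primInv_zero] using primInv_mono hΨpos hint le_rfl hx.1 hx.2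

/-- The supporting line inequality for the convex function `x ↦ x * ∫₀ˣ ds/φ(s)`. -/
lemma mul_primInv_tangent {Ψ : ℝ → ℝ} (hΨpos : ∀ s ∈ Set.Ioc (0:ℝ) 1, 0 < Ψ s)
    (hΨdec : AntitoneOn Ψ (Set.Ioc (0:ℝ) 1))
    (hφinc : MonotoneOn (fun s => s * Ψ s) (Set.Ioc (0:ℝ) 1))
    (hint : IntegrableOn (fun s => (s * Ψ s)⁻¹) (Set.Ioo (0:ℝ) 1))
    {x y : ℝ} (hx : x ∈ Set.Ioc (0:ℝ) 1) (hy : y ∈ Set.Icc (0:ℝ) 1) :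
    x * primInv Ψ x + (primInv Ψ x + (Ψ x)⁻¹) * (y - x) ≤ y * primInv Ψ y := by
  have hΨx := hΨpos x hx
  suffices h : (Ψ x)⁻¹ * (y - x) ≤ y * (primInv Ψ y - primInv Ψ x) by linarith
  obtain ⟨hy, hy1⟩ := hy
  rcases hy.eq_or_lt with rfl | hy0
  · have := mul_pos (inv_pos.2 hΨx) hx.1
    linarith
  have hΨy := hΨpos y ⟨hy0, hy1⟩
  have hcancel : y * ((y - x) * (y * Ψ y)⁻¹) = (Ψ y)⁻¹ * (y - x) := by field_simp
  rcases le_total x y with hxy | hxy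
  · have h1 := mul_le_mul_of_nonneg_left
      (primInv_sub_bounds hΨpos hφinc hint hx.1 hxy hy1).1 hy
    have h2 : (Ψ x)⁻¹ ≤ (Ψ y)⁻¹ := inv_anti₀ hΨy (hΨdec hx ⟨hy0, hy1⟩ hxy)
    have h3 := mul_le_mul_of_nonneg_right h2 (sub_nonneg.2 hxy)
    linarith
  · have h1 := mul_le_mul_of_nonneg_left
      (primInv_sub_bounds hΨpos hφinc hint hy0 hxy hx.2).2 hy
    have h2 : (Ψ y)⁻¹ ≤ (Ψ x)⁻¹ := inv_anti₀ hΨx (hΨdec ⟨hy0, hy1⟩ hx hxy)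
    have h3 := mul_le_mul_of_nonneg_right h2 (sub_nonneg.2 hxy)
    linarith

lemma TT_eq (Ψ : ℝ → ℝ) (A N : ℝ) : TT Ψ A N = N * primInv Ψ (N / A) := rfl

lemma div_mem_Icc_zero_one {A N : ℝ} (hA : 1 ≤ A) (hN : N ∈ Set.Icc (0:ℝ) 1) :
    N / A ∈ Set.Icc (0:ℝ) 1 :=
  ⟨div_nonneg hN.1 (by linarith), (div_le_one (by linarith)).2 (hN.2.trans hA)⟩

lemma TT_nonneg {Ψ : ℝ → ℝ} (hΨpos : ∀ s ∈ Set.Ioc (0:ℝ) 1, 0 < Ψ s)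
    (hint : IntegrableOn (fun s => (s * Ψ s)⁻¹) (Set.Ioo (0:ℝ) 1))
    {A N : ℝ} (hA : 1 ≤ A) (hN : N ∈ Set.Icc (0:ℝ) 1) : 0 ≤ TT Ψ A N :=
  mul_nonneg hN.1 (primInv_nonneg hΨpos hint (div_mem_Icc_zero_one hA hN))

lemma TT_le {Ψ : ℝ → ℝ} (hΨpos : ∀ s ∈ Set.Ioc (0:ℝ) 1, 0 < Ψ s)
    (hint : IntegrableOn (fun s => (s * Ψ s)⁻¹) (Set.Ioo (0:ℝ) 1))
    (hnorm : (∫ s in Set.Ioo (0:ℝ) 1, (s * Ψ s)⁻¹) = 1)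
    {A N : ℝ} (hA : 1 ≤ A) (hN : N ∈ Set.Icc (0:ℝ) 1) : TT Ψ A N ≤ N := by
  have h := div_mem_Icc_zero_one hA hN
  have h1 : primInv Ψ (N / A) ≤ 1 := (primInv_mono hΨpos hint h.1 h.2 le_rfl).trans_eq hnorm
  exact mul_le_of_le_one_right hN.1 h1

lemma TT_mono {Ψ : ℝ → ℝ} (hΨpos : ∀ s ∈ Set.Ioc (0:ℝ) 1, 0 < Ψ s)
    (hint : IntegrableOn (fun s => (s * Ψ s)⁻¹) (Set.Ioo (0:ℝ) 1))
    {A : ℝ} (hA : 1 ≤ A) : MonotoneOn (TT Ψ A) (Set.Icc (0:ℝ) 1) := fun N hN N' hN' h =>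
  mul_le_mul h
    (primInv_mono hΨpos hint (div_mem_Icc_zero_one hA hN).1
      (div_le_div_of_nonneg_right h (by linarith)) (div_mem_Icc_zero_one hA hN').2)
    (primInv_nonneg hΨpos hint (div_mem_Icc_zero_one hA hN)) hN'.1

lemma integrableOn_TT {Ψ : ℝ → ℝ} (hΨpos : ∀ s ∈ Set.Ioc (0:ℝ) 1, 0 < Ψ s)
    (hint : IntegrableOn (fun s => (s * Ψ s)⁻¹) (Set.Ioo (0:ℝ) 1))
    (hnorm : (∫ s in Set.Ioo (0:ℝ) 1, (s * Ψ s)⁻¹) = 1)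
    {A : ℝ} (hA : 1 ≤ A) {N : ℝ → ℝ} (hN : IsDistFun N) :
    IntegrableOn (fun t => TT Ψ A (N t)) (Set.Ioi 0) := by
  obtain ⟨hanti, hmem, hNint⟩ := hN
  have hmeas : AEStronglyMeasurable (fun t => TT Ψ A (N t)) (volume.restrict (Set.Ioi 0)) :=
    (aemeasurable_restrict_of_antitoneOn measurableSet_Ioi fun s hs t ht hst =>
      TT_mono hΨpos hint hA (hmem t (le_of_lt ht)) (hmem s (le_of_lt hs))
        (hanti (Set.Ioi_subset_Ici_self hs) (Set.Ioi_subset_Ici_self ht) hst)).aestronglyMeasurable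
  refine Integrable.mono' hNint hmeas ?_
  filter_upwards [ae_restrict_mem measurableSet_Ioi] with t ht
  have h := hmem t (le_of_lt ht)
  rw [Real.norm_of_nonneg (TT_nonneg hΨpos hint hA h)]
  exact TT_le hΨpos hint hnorm hA h

lemma uMN_bounds {Ψ : ℝ → ℝ} (hΨpos : ∀ s ∈ Set.Ioc (0:ℝ) 1, 0 < Ψ s)
    (hint : IntegrableOn (fun s => (s * Ψ s)⁻¹) (Set.Ioo (0:ℝ) 1))
    (hnorm : (∫ s in Set.Ioo (0:ℝ) 1, (s * Ψ s)⁻¹) = 1)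
    {M : ℝ} (hM : 0 ≤ M) {N : ℝ → ℝ} (hN : IsDistFun N) :
    (∫ t in Set.Ioi (0:ℝ), N t) ≤ uMN Ψ M N ∧
      uMN Ψ M N ≤ 2 * ∫ t in Set.Ioi (0:ℝ), N t := by
  have hA : 1 ≤ M + 1 := by linarith
  have h0 : 0 ≤ bigT Ψ (M + 1) N := setIntegral_nonneg measurableSet_Ioi fun t ht =>
    TT_nonneg hΨpos hint hA (hN.2.1 t (le_of_lt ht))
  have h1 : bigT Ψ (M + 1) N ≤ ∫ t in Set.Ioi (0:ℝ), N t :=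
    setIntegral_mono_on (integrableOn_TT hΨpos hint hnorm hA hN) hN.2.2 measurableSet_Ioi
      fun t ht => TT_le hΨpos hint hnorm hA (hN.2.1 t (le_of_lt ht))
  unfold uMN
  constructor <;> linarith

lemma IsDistFun.sum {n : ℕ} {α : Fin n → ℝ} {Ns : Fin n → ℝ → ℝ}
    (hα : ∀ k, 0 ≤ α k) (hαsum : ∑ k, α k = 1) (hNs : ∀ k, IsDistFun (Ns k)) :
    IsDistFun (fun t => ∑ k, α k * Ns k t) := by
  refine ⟨fun s hs t ht hst => ?_, fun t ht => ⟨?_, ?_⟩, ?_⟩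
  · exact Finset.sum_le_sum fun k _ => mul_le_mul_of_nonneg_left ((hNs k).1 hs ht hst) (hα k)
  · exact Finset.sum_nonneg fun k _ => mul_nonneg (hα k) ((hNs k).2.1 t ht).1
  · rw [← hαsum]
    exact Finset.sum_le_sum fun k _ => mul_le_of_le_one_right (hα k) ((hNs k).2.1 t ht).2
  · exact integrable_finsetSum _ fun k _ => (hNs k).2.2.const_mul (α k)

/-- The derivative of `T` in `A` is at least `N / (4Ψ(N))` in absolute value; the latter is
bounded below by a linearization of Cauchy–Schwarz with parameter `l`. -/
lemma div_lower_bound {Ψ : ℝ → ℝ} (hΨpos : ∀ s ∈ Set.Ioc (0:ℝ) 1, 0 < Ψ s)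
    (hφinc : MonotoneOn (fun s => s * Ψ s) (Set.Ioc (0:ℝ) 1))
    {A N : ℝ} (hA : 1 ≤ A) (hA2 : A ≤ 2) (hN : N ∈ Set.Ioc (0:ℝ) 1) (l : ℝ) :
    1 / 4 * (2 * l * N - l ^ 2 * (N * Ψ N)) ≤ N / A * (Ψ (N / A))⁻¹ := by
  have hA0 : 0 < A := by linarith
  have hx0 : 0 < N / A := div_pos hN.1 hA0
  have hxN : N / A ≤ N := div_le_self hN.1.le hA
  have hx1 : N / A ≤ 1 := hxN.trans hN.2
  have hΨx := hΨpos _ ⟨hx0, hx1⟩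
  have hΨN := hΨpos _ hN
  have hφ : N / A * Ψ (N / A) ≤ N * Ψ N := hφinc ⟨hx0, hx1⟩ hN hxN
  have hhalf : N / 2 ≤ N / A := div_le_div_of_nonneg_left hN.1.le hA0 hA2
  have h1 : (N / 2) ^ 2 / (N * Ψ N) ≤ N / A * (Ψ (N / A))⁻¹ := by
    have : N / A * (Ψ (N / A))⁻¹ = (N / A) ^ 2 / (N / A * Ψ (N / A)) := by
      field_simp
    rw [this]
    have hN0 := hN.1
    gcongr
  refine le_trans ?_ h1
  rw [le_div_iff₀ (mul_pos hN.1 hΨN)]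
  nlinarith [sq_nonneg (N * (1 - l * Ψ N))]

/-- Joint convexity of `T` along a convex combination, with the gain produced by `a`. -/
lemma TT_sum_lower_bound {Ψ : ℝ → ℝ} (hΨpos : ∀ s ∈ Set.Ioc (0:ℝ) 1, 0 < Ψ s)
    (hΨdec : AntitoneOn Ψ (Set.Ioc (0:ℝ) 1))
    (hφinc : MonotoneOn (fun s => s * Ψ s) (Set.Ioc (0:ℝ) 1))
    (hint : IntegrableOn (fun s => (s * Ψ s)⁻¹) (Set.Ioo (0:ℝ) 1))
    {n : ℕ} {α Ms Ns : Fin n → ℝ} {a : ℝ} (ha : 0 ≤ a)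
    (hα : ∀ k, 0 ≤ α k) (hαsum : ∑ k, α k = 1) (hNs : ∀ k, Ns k ∈ Set.Icc (0:ℝ) 1)
    (hMs : ∀ k, 0 ≤ Ms k) (hM : a + ∑ k, α k * Ms k ≤ 1) (l : ℝ) :
    TT Ψ (a + ∑ k, α k * Ms k + 1) (∑ k, α k * Ns k) +
      a / 4 * (2 * l * (∑ k, α k * Ns k) - l ^ 2 *
        (if ∑ k, α k * Ns k = 0 then 0 else (∑ k, α k * Ns k) * Ψ (∑ k, α k * Ns k))) ≤
      ∑ k, α k * TT Ψ (Ms k + 1) (Ns k) := by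
  have hS : 0 ≤ ∑ k, α k * Ms k := Finset.sum_nonneg fun k _ => mul_nonneg (hα k) (hMs k)
  have hN0 : 0 ≤ ∑ k, α k * Ns k := Finset.sum_nonneg fun k _ => mul_nonneg (hα k) (hNs k).1
  have hN1 : ∑ k, α k * Ns k ≤ 1 := by
    rw [← hαsum]
    exact Finset.sum_le_sum fun k _ => mul_le_of_le_one_right (hα k) (hNs k).2
  have hA1 : ∀ k, 1 ≤ Ms k + 1 := fun k => by linarith [hMs k]
  rcases hN0.eq_or_lt with h0 | hpos
  · rw [← h0]
    simp only [TT_eq Ψ (a + ∑ k, α k * Ms k + 1), zero_mul, mul_zero, if_true, sub_zero, add_zero]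
    exact Finset.sum_nonneg fun k _ => mul_nonneg (hα k) (TT_nonneg hΨpos hint (hA1 k) (hNs k))
  rw [if_neg hpos.ne']
  set S := ∑ k, α k * Ms k with hSdef
  set N := ∑ k, α k * Ns k with hNdef
  set A := a + S + 1 with hAdef
  have hA : 1 ≤ A := by linarith
  have hA0 : 0 < A := by linarith
  set x := N / A with hx
  have hxA : x * A = N := div_mul_cancel₀ _ hA0.ne'
  have hxm : x ∈ Set.Ioc (0:ℝ) 1 := ⟨div_pos hpos hA0, (div_mem_Icc_zero_one hA ⟨hN0, hN1⟩).2⟩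
  have hgain := mul_le_mul_of_nonneg_left
    (div_lower_bound hΨpos hφinc hA (by linarith) ⟨hpos, hN1⟩ l) ha
  rw [← hx] at hgain
  set g := primInv Ψ x
  set p := (Ψ x)⁻¹
  have hk : ∀ k, α k * ((Ms k + 1) * (x * g) + (g + p) * (Ns k - x * (Ms k + 1))) ≤
      α k * TT Ψ (Ms k + 1) (Ns k) := fun k => by
    refine mul_le_mul_of_nonneg_left ?_ (hα k)
    have hAk : 0 < Ms k + 1 := by linarith [hMs k]
    have h := mul_le_mul_of_nonneg_left (mul_primInv_tangent hΨpos hΨdec hφinc hint hxm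
      (div_mem_Icc_zero_one (hA1 k) (hNs k))) hAk.le
    have hdiv : (Ms k + 1) * (Ns k / (Ms k + 1)) = Ns k := mul_div_cancel₀ _ hAk.ne'
    rw [← mul_assoc (Ms k + 1) (Ns k / (Ms k + 1)), hdiv, ← TT_eq] at h
    refine le_trans (le_of_eq ?_) h
    linear_combination -(g + p) * hdiv
  refine le_trans ?_ (Finset.sum_le_sum fun k _ => hk k)
  have hsum : ∑ k, α k * ((Ms k + 1) * (x * g) + (g + p) * (Ns k - x * (Ms k + 1))) =
      (S + 1) * (x * g) + (g + p) * (N - x * (S + 1)) := by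
    have hterm : ∀ k, α k * ((Ms k + 1) * (x * g) + (g + p) * (Ns k - x * (Ms k + 1))) =
        α k * Ms k * -(x * p) + α k * -(x * p) + α k * Ns k * (g + p) := fun k => by ring
    simp only [hterm, Finset.sum_add_distrib, ← Finset.sum_mul, hαsum, ← hSdef, ← hNdef]
    ring
  rw [hsum, TT_eq, ← hx]
  change N * g + _ ≤ _
  have : (S + 1) * (x * g) + (g + p) * (N - x * (S + 1)) = N * g + a * (x * p) := by
    rw [← hxA, hAdef]
    ring
  rw [this]
  linarith

lemma uMN_sum_le {Ψ : ℝ → ℝ} (hΨpos : ∀ s ∈ Set.Ioc (0:ℝ) 1, 0 < Ψ s)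
    (hΨdec : AntitoneOn Ψ (Set.Ioc (0:ℝ) 1))
    (hφinc : MonotoneOn (fun s => s * Ψ s) (Set.Ioc (0:ℝ) 1))
    (hint : IntegrableOn (fun s => (s * Ψ s)⁻¹) (Set.Ioo (0:ℝ) 1))
    (hnorm : (∫ s in Set.Ioo (0:ℝ) 1, (s * Ψ s)⁻¹) = 1)
    {n : ℕ} {α Ms : Fin n → ℝ} {Ns : Fin n → ℝ → ℝ} {a : ℝ} (ha : 0 ≤ a)
    (hα : ∀ k, 0 ≤ α k) (hαsum : ∑ k, α k = 1) (hNs : ∀ k, IsDistFun (Ns k))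
    (hMs : ∀ k, 0 ≤ Ms k) (hM : a + ∑ k, α k * Ms k ≤ 1) {l : ℝ}
    (hl : l = 0 ∨ IntegrableOn (fun t => if ∑ k, α k * Ns k t = 0 then 0 else
      (∑ k, α k * Ns k t) * Ψ (∑ k, α k * Ns k t)) (Set.Ioi 0)) :
    ∑ k, α k * uMN Ψ (Ms k) (Ns k) +
      a / 4 * (2 * l * (∑ k, α k * ∫ t in Set.Ioi (0:ℝ), Ns k t) -
        l ^ 2 * nPsi Ψ (fun t => ∑ k, α k * Ns k t)) ≤
      uMN Ψ (a + ∑ k, α k * Ms k) (fun t => ∑ k, α k * Ns k t) := by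
  have hS : 0 ≤ ∑ k, α k * Ms k := Finset.sum_nonneg fun k _ => mul_nonneg (hα k) (hMs k)
  have hD := IsDistFun.sum hα hαsum hNs
  have hI : ∫ t in Set.Ioi (0:ℝ), ∑ k, α k * Ns k t =
      ∑ k, α k * ∫ t in Set.Ioi (0:ℝ), Ns k t := by
    rw [integral_finsetSum _ fun k _ => (hNs k).2.2.const_mul (α k)]
    simp only [integral_const_mul]
  have hTk : ∀ k, IntegrableOn (fun t => α k * TT Ψ (Ms k + 1) (Ns k t)) (Set.Ioi 0) := fun k =>
    (integrableOn_TT hΨpos hint hnorm (by linarith [hMs k]) (hNs k)).const_mul (α k)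
  have hT := integrableOn_TT hΨpos hint hnorm
    (show 1 ≤ a + ∑ k, α k * Ms k + 1 by linarith) hD
  have hP : IntegrableOn (fun t => l ^ 2 * if ∑ k, α k * Ns k t = 0 then 0 else
      (∑ k, α k * Ns k t) * Ψ (∑ k, α k * Ns k t)) (Set.Ioi 0) := by
    rcases hl with rfl | hl
    · simp
    · exact hl.const_mul _
  have hG := ((hD.2.2.const_mul (2 * l)).sub hP).const_mul (a / 4)
  have key := setIntegral_mono_on (hT.add hG) (integrable_finsetSum Finset.univ fun k _ => hTk k)
    measurableSet_Ioi fun t ht => TT_sum_lower_bound hΨpos hΨdec hφinc hint ha hα hαsum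
      (fun k => (hNs k).2.1 t (le_of_lt ht)) hMs hM l
  have hL := integral_add hT hG
  have hR := integral_finsetSum (μ := volume.restrict (Set.Ioi 0)) Finset.univ fun k _ => hTk k
  have hsub := integral_sub (hD.2.2.const_mul (2 * l)) hP
  simp only [Pi.add_apply, Pi.sub_apply, integral_const_mul] at key hL hR hsub
  rw [hL, hR, hsub, hI] at key
  have hv : ∑ k, α k * uMN Ψ (Ms k) (Ns k) =
      2 * (∑ k, α k * ∫ t in Set.Ioi (0:ℝ), Ns k t) -
        ∑ k, α k * bigT Ψ (Ms k + 1) (Ns k) := by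
    rw [Finset.mul_sum, ← Finset.sum_sub_distrib]
    exact Finset.sum_congr rfl fun k _ => by rw [uMN]; ring
  rw [hv, uMN, hI]
  change bigT Ψ _ _ + a / 4 * (_ - l ^ 2 * nPsi Ψ _) ≤ ∑ k, α k * bigT Ψ _ _ at key
  linarith

/-- Cauchy–Schwarz in Engel form with weights, some of which may vanish. -/
lemma sq_sum_div_le_sum_mul_sq_div {n : ℕ} {α fs us : Fin n → ℝ} (hα : ∀ k, 0 ≤ α k)
    (hus : ∀ k, 0 < us k) (hv : 0 < ∑ k, α k * us k) :
    (∑ k, α k * fs k) ^ 2 / (∑ k, α k * us k) ≤ ∑ k, α k * (fs k ^ 2 / us k) := by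
  set v := ∑ k, α k * us k with hvdef
  set f := ∑ k, α k * fs k with hfdef
  have hk : ∀ k, α k * (2 * (f / v) * fs k - (f / v) ^ 2 * us k) ≤ α k * (fs k ^ 2 / us k) :=
    fun k => by
      refine mul_le_mul_of_nonneg_left ?_ (hα k)
      rw [le_div_iff₀ (hus k)]
      nlinarith [sq_nonneg (fs k - f / v * us k)]
  refine le_trans (le_of_eq ?_) (Finset.sum_le_sum fun k _ => hk k)
  have : ∑ k, α k * (2 * (f / v) * fs k - (f / v) ^ 2 * us k) =
      2 * (f / v) * f - (f / v) ^ 2 * v := by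
    rw [hfdef, hvdef, Finset.mul_sum, Finset.mul_sum, ← Finset.sum_sub_distrib]
    exact Finset.sum_congr rfl fun k _ => by ring
  rw [this]
  field_simp
  ring

/-- the finite-difference form (4.5) of the main inequality for the
Bellman function `B̃(f, N, M) = f²/u(M,N)` of the Carleson embedding theorem. -/
theorem statement18 (Ψ : ℝ → ℝ)
    (hΨpos : ∀ s ∈ Set.Ioc (0:ℝ) 1, 0 < Ψ s)
    (hΨdiff : DifferentiableOn ℝ Ψ (Set.Ioc (0:ℝ) 1))
    (hΨdec : AntitoneOn Ψ (Set.Ioc (0:ℝ) 1))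
    (hφinc : MonotoneOn (fun s => s * Ψ s) (Set.Ioc (0:ℝ) 1))
    (hnorm : (∫ s in Set.Ioo (0:ℝ) 1, (s * Ψ s)⁻¹) = 1)
    (n : ℕ) (hn : 1 ≤ n)
    (α fs Ms : Fin n → ℝ) (Ns : Fin n → ℝ → ℝ) (a : ℝ) (ha : 0 ≤ a)
    (hα : ∀ k, 0 ≤ α k) (hαsum : ∑ k, α k = 1)
    (hNs : ∀ k, IsDistFun (Ns k))
    (hNpos : ∀ k, 0 < ∫ t in Set.Ioi (0:ℝ), Ns k t)
    (hMs : ∀ k, Ms k ∈ Set.Icc (0:ℝ) 1)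
    (hM : a + ∑ k, α k * Ms k ∈ Set.Icc (0:ℝ) 1) :
    1 / 16 * a * (∑ k, α k * fs k) ^ 2 / nPsi Ψ (fun t => ∑ k, α k * Ns k t) ≤
      -B3 Ψ (∑ k, α k * fs k) (fun t => ∑ k, α k * Ns k t) (a + ∑ k, α k * Ms k) +
        ∑ k, α k * B3 Ψ (fs k) (Ns k) (Ms k) := by
  have hint : IntegrableOn (fun s => (s * Ψ s)⁻¹) (Set.Ioo (0:ℝ) 1) := by
    by_contra h
    rw [integral_undef h] at hnorm
    exact zero_ne_one hnorm
  have hMs0 : ∀ k, 0 ≤ Ms k := fun k => (hMs k).1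
  have hD := IsDistFun.sum hα hαsum hNs
  have hbound := uMN_bounds hΨpos hint hnorm hM.1 hD
  have hI : ∫ t in Set.Ioi (0:ℝ), ∑ k, α k * Ns k t =
      ∑ k, α k * ∫ t in Set.Ioi (0:ℝ), Ns k t := by
    rw [integral_finsetSum _ fun k _ => (hNs k).2.2.const_mul (α k)]
    simp only [integral_const_mul]
  have hu : ∀ k, (∫ t in Set.Ioi (0:ℝ), Ns k t) ≤ uMN Ψ (Ms k) (Ns k) := fun k =>
    (uMN_bounds hΨpos hint hnorm (hMs0 k) (hNs k)).1
  have hIpos : 0 < ∑ k, α k * ∫ t in Set.Ioi (0:ℝ), Ns k t := by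
    obtain ⟨k, -, hk⟩ : ∃ k ∈ Finset.univ, 0 < α k :=
      Finset.exists_lt_of_sum_lt (by simp [hαsum])
    exact Finset.sum_pos' (fun k _ => mul_nonneg (hα k) (hNpos k).le)
      ⟨k, Finset.mem_univ k, mul_pos hk (hNpos k)⟩
  have hIv : ∑ k, α k * ∫ t in Set.Ioi (0:ℝ), Ns k t ≤ ∑ k, α k * uMN Ψ (Ms k) (Ns k) :=
    Finset.sum_le_sum fun k _ => mul_le_mul_of_nonneg_left (hu k) (hα k)
  have hCS := sq_sum_div_le_sum_mul_sq_div (fs := fs) hα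
    (fun k => (hNpos k).trans_le (hu k)) (hIpos.trans_le hIv)
  have hmain := fun l => uMN_sum_le (l := l) hΨpos hΨdec hφinc hint hnorm ha hα hαsum hNs hMs0 hM.2
  have hP0 : 0 ≤ nPsi Ψ (fun t => ∑ k, α k * Ns k t) :=
    setIntegral_nonneg measurableSet_Ioi fun t ht => by
      dsimp only
      split_ifs with h
      · exact le_rfl
      · have hm := hD.2.1 t (le_of_lt ht)
        exact mul_nonneg hm.1 (hΨpos _ ⟨lt_of_le_of_ne hm.1 (Ne.symm h), hm.2⟩).le
  rw [hI] at hbound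
  unfold B3
  set u := uMN Ψ (a + ∑ k, α k * Ms k) (fun t => ∑ k, α k * Ns k t)
  set v := ∑ k, α k * uMN Ψ (Ms k) (Ns k)
  set f := ∑ k, α k * fs k
  set I := ∑ k, α k * ∫ t in Set.Ioi (0:ℝ), Ns k t
  have hvu : v ≤ u := by simpa using hmain 0 (Or.inl rfl)
  have hv : 0 < v := hIpos.trans_le hIv
  have hupos : 0 < u := hv.trans_le hvu
  have hdiff : f ^ 2 * (u - v) / (4 * I ^ 2) ≤ f ^ 2 / v - f ^ 2 / u := by
    have h1 : f ^ 2 / v - f ^ 2 / u = f ^ 2 * (u - v) / (u * v) := by field_simp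
    rw [h1]
    refine div_le_div_of_nonneg_left (mul_nonneg (sq_nonneg f) (sub_nonneg.2 hvu))
      (mul_pos hupos hv) ?_
    nlinarith [hbound.2]
  suffices h : 1 / 16 * a * f ^ 2 / nPsi Ψ (fun t => ∑ k, α k * Ns k t) ≤
      f ^ 2 * (u - v) / (4 * I ^ 2) by linarith
  have hnonneg : 0 ≤ f ^ 2 * (u - v) / (4 * I ^ 2) :=
    div_nonneg (mul_nonneg (sq_nonneg f) (sub_nonneg.2 hvu)) (by positivity)
  rcases hP0.eq_or_lt with h0 | hP
  · rwa [← h0, div_zero]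
  have hPint : IntegrableOn (fun t => if ∑ k, α k * Ns k t = 0 then 0 else
      (∑ k, α k * Ns k t) * Ψ (∑ k, α k * Ns k t)) (Set.Ioi 0) := by
    by_contra h
    exact hP.ne' (integral_undef h)
  have hgain := hmain (I / nPsi Ψ (fun t => ∑ k, α k * Ns k t)) (Or.inr hPint)
  set P := nPsi Ψ (fun t => ∑ k, α k * Ns k t)
  have hgain' : a / 4 * (I ^ 2 / P) ≤ u - v := by
    have h1 : 2 * (I / P) * I - (I / P) ^ 2 * P = I ^ 2 / P := by
      field_simp
      ring
    rw [h1] at hgain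
    linarith
  rw [le_div_iff₀ (by positivity)]
  have h2 := mul_le_mul_of_nonneg_left hgain' (sq_nonneg f)
  refine le_trans (le_of_eq ?_) h2
  ring
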